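/- Let α ∈ (0,1) and C₀ > 0. Suppose u is a smooth real-valued function on (0,1/2) × ℝ, 2π-periodic in θ, such that u ∈ Õ(0) and |∂_ρ u(ρ,θ)| + ρ^{-1}|∂_θ u(ρ,θ)| ≤ C₀ ρ^α for all (ρ,θ) with 0 < ρ < 1/2. Then u(ρ,θ) converges, as ρ → 0, to a constant c independent of θ, and for every q with 1 < q < 1 + α the function u − c belongs to Õ(q). In particular there is some q > 1 such that u = c + Õ(q). -/

import Mathlib

open Real Set

/-- Partial derivative in the `ρ` variable of a function of `(ρ, θ)`. -/
noncomputable def pd_rho (u : ℝ → ℝ → ℝ) : ℝ → ℝ → ℝ :=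
  fun ρ θ => deriv (fun r => u r θ) ρ

/-- Partial derivative in the `θ` variable of a function of `(ρ, θ)`. -/
noncomputable def pd_theta (u : ℝ → ℝ → ℝ) : ℝ → ℝ → ℝ :=
  fun ρ θ => deriv (fun t => u ρ t) θ

/-- The operator `u ↦ ρ ∂_ρ u`. -/
noncomputable def rhoDrho (u : ℝ → ℝ → ℝ) : ℝ → ℝ → ℝ :=
  fun ρ θ => ρ * deriv (fun r => u r θ) ρ

/-- The model Laplacian `Δ̃ = ∂_ρ² + ρ⁻¹ ∂_ρ + β⁻² ρ⁻² ∂_θ²`. -/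
noncomputable def tLap (β : ℝ) (u : ℝ → ℝ → ℝ) : ℝ → ℝ → ℝ :=
  fun ρ θ => pd_rho (pd_rho u) ρ θ + ρ⁻¹ * pd_rho u ρ θ
    + (β ^ 2)⁻¹ * (ρ ^ 2)⁻¹ * pd_theta (pd_theta u) ρ θ

/-- The function `ρ^{2j+k/β} (log ρ)^m cos (l θ)`. -/
noncomputable def tlogCos (β : ℝ) (j k m l : ℕ) : ℝ → ℝ → ℝ :=
  fun ρ θ => ρ ^ (2 * (j : ℝ) + (k : ℝ) / β) * (Real.log ρ) ^ m * Real.cos (l * θ)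

/-- The function `ρ^{2j+k/β} (log ρ)^m sin (l θ)`. -/
noncomputable def tlogSin (β : ℝ) (j k m l : ℕ) : ℝ → ℝ → ℝ :=
  fun ρ θ => ρ ^ (2 * (j : ℝ) + (k : ℝ) / β) * (Real.log ρ) ^ m * Real.sin (l * θ)

/-- Index conditions for `T_log`: `k - l` is a nonnegative even integer and
`m ≤ max (0, k - 1)`. -/
def TlogIdx (j k m l : ℕ) : Prop :=
  (∃ i : ℕ, k = l + 2 * i) ∧ m ≤ max 0 (k - 1)

/-- The set `T_log` of model functions. -/
def Tlog (β : ℝ) : Set (ℝ → ℝ → ℝ) :=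
  {f | ∃ j k m l : ℕ, TlogIdx j k m l ∧ (f = tlogCos β j k m l ∨ f = tlogSin β j k m l)}

/-- The functions removed from `ρ⁻² · T_log` to form `T_rhs`. -/
def TrhsBad (β : ℝ) : Set (ℝ → ℝ → ℝ) :=
  {g | (g = fun ρ _ => ρ ^ (-2 : ℝ)) ∨
    ∃ k : ℕ, 0 < k ∧
      (g = (fun ρ θ => ρ ^ ((k : ℝ) / β - 2) * (Real.log ρ) ^ (k - 1) * Real.cos (k * θ)) ∨
       g = (fun ρ θ => ρ ^ ((k : ℝ) / β - 2) * (Real.log ρ) ^ (k - 1) * Real.sin (k * θ)))}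

/-- The set `T_rhs`. -/
def Trhs (β : ℝ) : Set (ℝ → ℝ → ℝ) :=
  {g | ∃ f ∈ Tlog β, g = fun ρ θ => ρ ^ (-2 : ℝ) * f ρ θ} \ TrhsBad β

/-- Membership in `Õ(q)`: a smooth, `2π`-periodic (in `θ`) function on `(0,1/2) × ℝ`
all of whose weighted derivatives `(ρ∂_ρ)^{k₁} ∂_θ^{k₂} u` are bounded by `C ρ^q`. -/
def OTilde (q : ℝ) (u : ℝ → ℝ → ℝ) : Prop :=
  ContDiffOn ℝ (⊤ : ℕ∞) (Function.uncurry u) (Set.Ioo (0 : ℝ) (1 / 2) ×ˢ (Set.univ : Set ℝ)) ∧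
  (∀ ρ θ : ℝ, u ρ (θ + 2 * Real.pi) = u ρ θ) ∧
  ∀ k1 k2 : ℕ, ∃ C : ℝ, ∀ ρ θ : ℝ, 0 < ρ → ρ < 1 / 2 →
    |(rhoDrho^[k1] (pd_theta^[k2] u)) ρ θ| ≤ C * ρ ^ q

/-- `u` has an expansion up to order `q`. -/
def HasExpansion (β q : ℝ) (u : ℝ → ℝ → ℝ) : Prop :=
  ∃ η ∈ Submodule.span ℝ (Tlog β), OTilde q (fun ρ θ => u ρ θ - η ρ θ)

/-- The domain `(0,1/2) × ℝ`. -/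
def halfStrip : Set (ℝ × ℝ) := Set.Ioo (0 : ℝ) (1 / 2) ×ˢ (Set.univ : Set ℝ)

lemma isOpen_halfStrip : IsOpen halfStrip := isOpen_Ioo.prod isOpen_univ

/-- Smoothness of a function of `(ρ, θ)` on `(0,1/2) × ℝ`. -/
def StripSmooth (f : ℝ → ℝ → ℝ) : Prop :=
  ContDiffOn ℝ (⊤ : ℕ∞) (Function.uncurry f) halfStrip

/-- The weighted sup bound `|f| ≤ C ρ^a` on `(0,1/2) × ℝ`. -/
def WeightedBound (a : ℝ) (f : ℝ → ℝ → ℝ) : Prop :=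
  ∃ C : ℝ, ∀ ρ θ : ℝ, 0 < ρ → ρ < 1 / 2 → |f ρ θ| ≤ C * ρ ^ a

namespace StripSmooth

variable {f : ℝ → ℝ → ℝ} {ρ : ℝ}

lemma differentiableAt_uncurry (hf : StripSmooth f) (h0 : 0 < ρ) (h1 : ρ < 1 / 2) (θ : ℝ) :
    DifferentiableAt ℝ (Function.uncurry f) (ρ, θ) :=
  ((hf.differentiableOn (by simp)) (ρ, θ) ⟨⟨h0, h1⟩, mem_univ _⟩).differentiableAt
    (isOpen_halfStrip.mem_nhds ⟨⟨h0, h1⟩, mem_univ _⟩)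

lemma hasDerivAt_rho (hf : StripSmooth f) (h0 : 0 < ρ) (h1 : ρ < 1 / 2) (θ : ℝ) :
    HasDerivAt (fun r => f r θ) (fderiv ℝ (Function.uncurry f) (ρ, θ) (1, 0)) ρ :=
  (hf.differentiableAt_uncurry h0 h1 θ).hasFDerivAt.comp_hasDerivAt ρ
    (f := fun r => (r, θ)) ((hasDerivAt_id ρ).prodMk (hasDerivAt_const ρ θ))

lemma hasDerivAt_theta (hf : StripSmooth f) (h0 : 0 < ρ) (h1 : ρ < 1 / 2) (θ : ℝ) :
    HasDerivAt (fun t => f ρ t) (fderiv ℝ (Function.uncurry f) (ρ, θ) (0, 1)) θ :=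
  (hf.differentiableAt_uncurry h0 h1 θ).hasFDerivAt.comp_hasDerivAt θ
    (f := fun t => (ρ, t)) ((hasDerivAt_const θ ρ).prodMk (hasDerivAt_id θ))

lemma hasDerivAt_pd_rho (hf : StripSmooth f) (h0 : 0 < ρ) (h1 : ρ < 1 / 2) (θ : ℝ) :
    HasDerivAt (fun r => f r θ) (pd_rho f ρ θ) ρ :=
  (hf.hasDerivAt_rho h0 h1 θ).differentiableAt.hasDerivAt

lemma hasDerivAt_pd_theta (hf : StripSmooth f) (h0 : 0 < ρ) (h1 : ρ < 1 / 2) (θ : ℝ) :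
    HasDerivAt (fun t => f ρ t) (pd_theta f ρ θ) θ :=
  (hf.hasDerivAt_theta h0 h1 θ).differentiableAt.hasDerivAt

lemma contDiffOn_fderiv_apply (hf : StripSmooth f) (v : ℝ × ℝ) :
    ContDiffOn ℝ (⊤ : ℕ∞) (fun p => fderiv ℝ (Function.uncurry f) p v) halfStrip :=
  (hf.fderiv_of_isOpen (m := (⊤ : ℕ∞)) isOpen_halfStrip (by simp)).clm_apply contDiffOn_const

protected lemma pd_theta (hf : StripSmooth f) : StripSmooth (pd_theta f) :=
  (hf.contDiffOn_fderiv_apply (0, 1)).congr fun p hp =>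
    (hf.hasDerivAt_theta hp.1.1 hp.1.2 p.2).deriv

protected lemma rhoDrho (hf : StripSmooth f) : StripSmooth (rhoDrho f) :=
  (contDiffOn_fst.mul (hf.contDiffOn_fderiv_apply (1, 0))).congr fun p hp =>
    congrArg (p.1 * ·) (hf.hasDerivAt_rho hp.1.1 hp.1.2 p.2).deriv

lemma iterate_pd_theta (hf : StripSmooth f) (k : ℕ) : StripSmooth (pd_theta^[k] f) := by
  induction k with
  | zero => exact hf
  | succ k ih =>
    rw [Function.iterate_succ_apply']
    exact ih.pd_theta

lemma iterate_rhoDrho (hf : StripSmooth f) (k : ℕ) : StripSmooth (rhoDrho^[k] f) := by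
  induction k with
  | zero => exact hf
  | succ k ih =>
    rw [Function.iterate_succ_apply']
    exact ih.rhoDrho

lemma sub_const (hf : StripSmooth f) (c : ℝ) : StripSmooth (fun ρ θ => f ρ θ - c) :=
  ContDiffOn.sub hf contDiffOn_const

end StripSmooth

lemma WeightedBound.mono {f : ℝ → ℝ → ℝ} {a b : ℝ} (hab : b ≤ a) (hf : WeightedBound a f) :
    WeightedBound b f := by
  obtain ⟨C, hC⟩ := hf
  refine ⟨|C|, fun ρ θ h0 h1 => (hC ρ θ h0 h1).trans ?_⟩
  exact mul_le_mul (le_abs_self C) (rpow_le_rpow_of_exponent_ge h0 (by linarith) hab)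
    (rpow_nonneg h0.le _) (abs_nonneg C)

/-- One-sided Landau inequality for the first derivative. -/
lemma abs_deriv_le_of_abs_le {g g' g'' : ℝ → ℝ} {t h M K : ℝ} (hh : 0 < h)
    (hg : ∀ s ∈ Icc (t - h) t, HasDerivAt g (g' s) s)
    (hg' : ∀ s ∈ Icc (t - h) t, HasDerivAt g' (g'' s) s)
    (hM : ∀ s ∈ Icc (t - h) t, |g s| ≤ M) (hK : ∀ s ∈ Icc (t - h) t, |g'' s| ≤ K) :
    |g' t| ≤ 2 * M / h + K * h := by
  have hlt : t - h < t := by linarith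
  have hl : t - h ∈ Icc (t - h) t := left_mem_Icc.2 hlt.le
  have hr : t ∈ Icc (t - h) t := right_mem_Icc.2 hlt.le
  obtain ⟨s, hs, hgs⟩ := exists_hasDerivAt_eq_slope g g' hlt
    (fun s hs => (hg s hs).continuousAt.continuousWithinAt)
    (fun s hs => hg s (Ioo_subset_Icc_self hs))
  have hs' := Ioo_subset_Icc_self hs
  have hfirst : |g' s| ≤ 2 * M / h := by
    rw [hgs, sub_sub_cancel, abs_div, abs_of_pos hh]
    gcongr
    linarith [abs_sub (g t) (g (t - h)), hM _ hl, hM _ hr]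
  have hsecond : |g' t - g' s| ≤ K * h := by
    have hmv := (convex_Icc (t - h) t).norm_image_sub_le_of_norm_hasDerivWithin_le
      (fun x hx => (hg' x hx).hasDerivWithinAt) hK hs' hr
    refine hmv.trans (mul_le_mul_of_nonneg_left ?_ ((abs_nonneg _).trans (hK _ hl)))
    rw [Real.norm_eq_abs, abs_of_nonneg (by linarith [hs.2])]
    linarith [hs.1]
  linarith [abs_sub_abs_le_abs_sub (g' t) (g' s)]

lemma two_mul_div_rpow_add_mul_rpow {ρ : ℝ} (hρ : 0 < ρ) (a b C D : ℝ) :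
    2 * (C * ρ ^ a) / ρ ^ ((a - b) / 2) + D * ρ ^ b * ρ ^ ((a - b) / 2) =
      (2 * C + D) * ρ ^ ((a + b) / 2) := by
  have h1 : ρ ^ a / ρ ^ ((a - b) / 2) = ρ ^ ((a + b) / 2) := by
    rw [← rpow_sub hρ]; congr 1; ring
  have h2 : ρ ^ b * ρ ^ ((a - b) / 2) = ρ ^ ((a + b) / 2) := by
    rw [← rpow_add hρ]; congr 1; ring
  rw [mul_assoc D, h2, ← mul_assoc, mul_div_assoc, h1]
  ring

lemma WeightedBound.pd_theta_midpoint {f : ℝ → ℝ → ℝ} {a b : ℝ} (hs : StripSmooth f)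
    (ha : WeightedBound a f) (hb : WeightedBound b (pd_theta (pd_theta f))) :
    WeightedBound ((a + b) / 2) (pd_theta f) := by
  obtain ⟨C, hC⟩ := ha
  obtain ⟨D, hD⟩ := hb
  refine ⟨2 * C + D, fun ρ θ h0 h1 => ?_⟩
  rw [← two_mul_div_rpow_add_mul_rpow h0]
  exact abs_deriv_le_of_abs_le (rpow_pos_of_pos h0 _)
    (fun s _ => hs.hasDerivAt_pd_theta h0 h1 s)
    (fun s _ => hs.pd_theta.hasDerivAt_pd_theta h0 h1 s)
    (fun s _ => hC ρ s h0 h1) (fun s _ => hD ρ s h0 h1)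

lemma StripSmooth.hasDerivAt_comp_exp {f : ℝ → ℝ → ℝ} (hs : StripSmooth f) {s : ℝ}
    (h1 : exp s < 1 / 2) (θ : ℝ) :
    HasDerivAt (fun s => f (exp s) θ) (rhoDrho f (exp s) θ) s := by
  have h := (hs.hasDerivAt_pd_rho (exp_pos s) h1 θ).comp s (Real.hasDerivAt_exp s)
  rw [mul_comm] at h
  exact h

lemma mul_exp_rpow_le {a C s t : ℝ} (ha : 0 ≤ a) (hst : s ≤ t) :
    C * exp s ^ a ≤ |C| * exp t ^ a :=
  mul_le_mul (le_abs_self C) (rpow_le_rpow (exp_pos s).le (exp_le_exp.2 hst) ha)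
    (rpow_nonneg (exp_pos s).le _) (abs_nonneg C)

lemma WeightedBound.rhoDrho_midpoint {f : ℝ → ℝ → ℝ} {a b : ℝ} (hs : StripSmooth f)
    (h0a : 0 ≤ a) (h0b : 0 ≤ b)
    (ha : WeightedBound a f) (hb : WeightedBound b (rhoDrho (rhoDrho f))) :
    WeightedBound ((a + b) / 2) (rhoDrho f) := by
  obtain ⟨C, hC⟩ := ha
  obtain ⟨D, hD⟩ := hb
  refine ⟨2 * |C| + |D|, fun ρ θ h0 h1 => ?_⟩
  obtain ⟨t, rfl⟩ : ∃ t, exp t = ρ := ⟨log ρ, exp_log h0⟩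
  have hlt {s h : ℝ} (hs : s ∈ Icc (t - h) t) : exp s < 1 / 2 :=
    (exp_le_exp.2 hs.2).trans_lt h1
  rw [← two_mul_div_rpow_add_mul_rpow h0]
  exact abs_deriv_le_of_abs_le (g' := fun s => rhoDrho f (exp s) θ) (rpow_pos_of_pos h0 _)
    (fun s h => hs.hasDerivAt_comp_exp (hlt h) θ)
    (fun s h => hs.rhoDrho.hasDerivAt_comp_exp (hlt h) θ)
    (fun s h => (hC _ θ (exp_pos s) (hlt h)).trans (mul_exp_rpow_le h0a h.2))
    (fun s h => (hD _ θ (exp_pos s) (hlt h)).trans (mul_exp_rpow_le h0b h.2))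

/-- Iterating a midpoint inequality for a scale of exponents: the exponent of the zeroth term
propagates to all terms with an arbitrarily small loss. -/
lemma exponent_propagation {P : ℕ → ℝ → Prop}
    (mono : ∀ k a b, b ≤ a → P k a → P k b) (zero : ∀ k, P k 0)
    (mid : ∀ k a b, 0 ≤ a → 0 ≤ b → P k a → P (k + 2) b → P (k + 1) ((a + b) / 2))
    {a : ℝ} (h0 : P 0 a) (k : ℕ) {q : ℝ} (hq : q < a) : P k q := by
  have gain (n : ℕ) : ∀ k a, 0 ≤ a → P k a → P (k + 1) (n / (n + 2) * a) := by
    induction n with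
    | zero => intro k a _ _; simpa using zero (k + 1)
    | succ n ih =>
      intro k a ha h
      have hn : (0 : ℝ) ≤ n / (n + 2) := by positivity
      have h2 := ih _ _ (mul_nonneg hn ha) (ih k a ha h)
      refine mono _ _ _ ?_ (mid k _ _ ha (by positivity) h h2)
      have key : ((n + 1 : ℕ) : ℝ) / ((n + 1 : ℕ) + 2) ≤
          (1 + (n : ℝ) / (n + 2) * (n / (n + 2))) / 2 := by
        push_cast
        have hN : (0 : ℝ) < n + 2 := by positivity
        have hN' : (0 : ℝ) < n + 1 + 2 := by positivity
        have hid : (1 + (n : ℝ) / (n + 2) * (n / (n + 2))) / 2 - (n + 1) / (n + 1 + 2) =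
            2 / ((n + 2) ^ 2 * (n + 1 + 2)) := by
          field_simp
          ring
        have : (0 : ℝ) ≤ 2 / ((n + 2) ^ 2 * (n + 1 + 2)) := by positivity
        linarith
      nlinarith [mul_le_mul_of_nonneg_right key ha]
  have step (k : ℕ) (h : ∀ q < a, P k q) : ∀ q < a, P (k + 1) q := by
    intro q hq
    rcases le_or_gt q 0 with hq0 | hq0
    · exact mono _ _ _ hq0 (zero _)
    obtain ⟨r, hqr, hra⟩ := exists_between hq
    have hr : 0 < r := hq0.trans hqr
    obtain ⟨n, hn⟩ := exists_nat_gt (2 * q / (r - q))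
    refine mono _ _ _ ?_ (gain n k r hr.le (h r hra))
    rw [div_lt_iff₀ (by linarith)] at hn
    rw [div_mul_eq_mul_div, le_div_iff₀ (by positivity)]
    nlinarith
  induction k generalizing q with
  | zero => exact mono _ _ _ hq.le h0
  | succ k ih => exact step k (fun q hq => ih hq) q hq

lemma WeightedBound.iterate_pd_theta {f : ℝ → ℝ → ℝ} {a q : ℝ} (hs : StripSmooth f)
    (h0 : ∀ k, WeightedBound 0 (pd_theta^[k] f)) (ha : WeightedBound a f) (hq : q < a) (k : ℕ) :
    WeightedBound q (pd_theta^[k] f) := by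
  refine exponent_propagation (P := fun k a => WeightedBound a (pd_theta^[k] f))
    (fun _ _ _ h => WeightedBound.mono h) h0 (fun k a b _ _ h1 h2 => ?_) ha k hq
  simp only [Function.iterate_succ_apply'] at h2 ⊢
  exact h1.pd_theta_midpoint (hs.iterate_pd_theta k) h2

lemma WeightedBound.iterate_rhoDrho {f : ℝ → ℝ → ℝ} {a q : ℝ} (hs : StripSmooth f)
    (h0 : ∀ k, WeightedBound 0 (rhoDrho^[k] f)) (ha : WeightedBound a f) (hq : q < a) (k : ℕ) :
    WeightedBound q (rhoDrho^[k] f) := by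
  refine exponent_propagation (P := fun k a => WeightedBound a (rhoDrho^[k] f))
    (fun _ _ _ h => WeightedBound.mono h) h0 (fun k a b h0a h0b h1 h2 => ?_) ha k hq
  simp only [Function.iterate_succ_apply'] at h2 ⊢
  exact h1.rhoDrho_midpoint (hs.iterate_rhoDrho k) h0a h0b h2

/-- Decay of `f` alone upgrades to decay of all its weighted derivatives, with an arbitrarily
small loss in the exponent. -/
lemma OTilde.of_weightedBound {f : ℝ → ℝ → ℝ} {a q : ℝ} (hf : OTilde 0 f)
    (ha : WeightedBound a f) (hq : q < a) : OTilde q f := by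
  obtain ⟨hs, hper, hbd⟩ := hf
  refine ⟨hs, hper, fun k1 k2 => ?_⟩
  obtain ⟨r, hqr, hra⟩ := exists_between hq
  have htheta : WeightedBound r (pd_theta^[k2] f) :=
    ha.iterate_pd_theta hs (hbd 0) hra k2
  exact htheta.iterate_rhoDrho (StripSmooth.iterate_pd_theta hs k2) (fun k => hbd k k2) hqr k1

lemma pd_theta_sub_const (f : ℝ → ℝ → ℝ) (c : ℝ) :
    pd_theta (fun ρ θ => f ρ θ - c) = pd_theta f := by
  funext ρ θ
  exact deriv_sub_const c

lemma rhoDrho_sub_const (f : ℝ → ℝ → ℝ) (c : ℝ) :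
    rhoDrho (fun ρ θ => f ρ θ - c) = rhoDrho f := by
  funext ρ θ
  exact congrArg (ρ * ·) (deriv_sub_const c)

lemma OTilde.sub_const {f : ℝ → ℝ → ℝ} (hf : OTilde 0 f) (c : ℝ) :
    OTilde 0 (fun ρ θ => f ρ θ - c) := by
  obtain ⟨hs, hper, hbd⟩ := hf
  refine ⟨StripSmooth.sub_const hs c, fun ρ θ => congrArg (· - c) (hper ρ θ), fun k1 k2 => ?_⟩
  rcases k2 with _ | k2
  · rcases k1 with _ | k1
    · obtain ⟨C, hC⟩ := hbd 0 0
      refine ⟨C + |c|, fun ρ θ h0 h1 => ?_⟩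
      have := hC ρ θ h0 h1
      simp only [Function.iterate_zero, id_eq, rpow_zero, mul_one] at this ⊢
      linarith [abs_sub (f ρ θ) c]
    · simpa only [Function.iterate_succ_apply, Function.iterate_zero, id_eq, rhoDrho_sub_const]
        using hbd (k1 + 1) 0
  · simpa only [Function.iterate_succ_apply _ k2, pd_theta_sub_const] using hbd k1 (k2 + 1)

/-- a function in `Õ(0)` whose first derivatives satisfy the weighted
Hölder-type bound `|∂_ρ u| + ρ⁻¹|∂_θ u| ≤ C₀ ρ^α` converges to a constant `c` as `ρ → 0`,
and `u − c ∈ Õ(q)` for every `1 < q < 1 + α`. -/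
theorem stmt14 (β : ℝ) (hβ0 : 0 < β) (hβ1 : β < 1)
    (α C₀ : ℝ) (hα0 : 0 < α) (hα1 : α < 1) (hC₀ : 0 < C₀)
    (u : ℝ → ℝ → ℝ) (hu : OTilde 0 u)
    (hgrad : ∀ ρ θ : ℝ, 0 < ρ → ρ < 1 / 2 →
      |pd_rho u ρ θ| + ρ⁻¹ * |pd_theta u ρ θ| ≤ C₀ * ρ ^ α) :
    ∃ c : ℝ,
      (∀ θ : ℝ, Filter.Tendsto (fun ρ => u ρ θ) (nhdsWithin 0 (Set.Ioi 0)) (nhds c)) ∧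
      (∀ q : ℝ, 1 < q → q < 1 + α → OTilde q (fun ρ θ => u ρ θ - c)) ∧
      (∃ q : ℝ, 1 < q ∧ OTilde q (fun ρ θ => u ρ θ - c)) := by
  have hs : StripSmooth u := hu.1
  have hrho (ρ θ : ℝ) (h0 : 0 < ρ) (h1 : ρ < 1 / 2) : |pd_rho u ρ θ| ≤ C₀ * ρ ^ α := by
    have : 0 ≤ ρ⁻¹ * |pd_theta u ρ θ| := by positivity
    linarith [hgrad ρ θ h0 h1]
  have htheta (ρ θ : ℝ) (h0 : 0 < ρ) (h1 : ρ < 1 / 2) : |pd_theta u ρ θ| ≤ C₀ * ρ := by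
    have hle : ρ⁻¹ * |pd_theta u ρ θ| ≤ C₀ := by
      have : C₀ * ρ ^ α ≤ C₀ * 1 :=
        mul_le_mul_of_nonneg_left (rpow_le_one h0.le (by linarith) hα0.le) hC₀.le
      linarith [hgrad ρ θ h0 h1, abs_nonneg (pd_rho u ρ θ)]
    rwa [inv_mul_le_iff₀ h0, mul_comm] at hle
  have hmv (θ ρ s : ℝ) (hs0 : 0 < s) (hsρ : s ≤ ρ) (h1 : ρ < 1 / 2) :
      |u ρ θ - u s θ| ≤ C₀ * ρ ^ α * (ρ - s) := by
    have h := (convex_Icc s ρ).norm_image_sub_le_of_norm_hasDerivWithin_le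
      (f := fun r => u r θ) (C := C₀ * ρ ^ α)
      (fun x hx => (hs.hasDerivAt_pd_rho (hs0.trans_le hx.1)
        (hx.2.trans_lt h1) θ).hasDerivWithinAt)
      (fun x hx => (hrho x θ (hs0.trans_le hx.1) (hx.2.trans_lt h1)).trans
        (mul_le_mul_of_nonneg_left
          (rpow_le_rpow (hs0.trans_le hx.1).le hx.2 hα0.le) hC₀.le))
      (left_mem_Icc.2 hsρ) (right_mem_Icc.2 hsρ)
    rwa [Real.norm_eq_abs, Real.norm_eq_abs, abs_of_nonneg (sub_nonneg.2 hsρ)] at h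
  have hnear : Set.Ioo (0 : ℝ) (1 / 2) ∈ nhdsWithin 0 (Set.Ioi 0) :=
    Ioo_mem_nhdsGT (by norm_num)
  obtain ⟨c, hc⟩ : ∃ c, Filter.Tendsto (fun ρ => u ρ 0) (nhdsWithin 0 (Set.Ioi 0)) (nhds c) := by
    have hlip : LipschitzOnWith C₀.toNNReal (fun ρ => u ρ 0) (Set.Ioo 0 (1 / 2)) := by
      refine (convex_Ioo _ _).lipschitzOnWith_of_nnnorm_hasDerivWithin_le
        (fun x hx => (hs.hasDerivAt_pd_rho hx.1 hx.2 0).hasDerivWithinAt) (fun x hx => ?_)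
      rw [← NNReal.coe_le_coe, coe_nnnorm, Real.coe_toNNReal _ hC₀.le, Real.norm_eq_abs]
      exact (hrho x 0 hx.1 hx.2).trans (mul_le_of_le_one_right hC₀.le
        (rpow_le_one hx.1.le (by linarith [hx.2]) hα0.le))
    obtain ⟨g, hg, hgu⟩ := hlip.extend_real
    refine ⟨g 0, (hg.continuous.continuousAt.mono_left nhdsWithin_le_nhds).congr' ?_⟩
    filter_upwards [hnear] with ρ hρ using (hgu hρ).symm
  have htend (θ : ℝ) :
      Filter.Tendsto (fun ρ => u ρ θ) (nhdsWithin 0 (Set.Ioi 0)) (nhds c) := by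
    have hid : Filter.Tendsto (fun ρ : ℝ => C₀ * ρ * |θ - 0|)
        (nhdsWithin 0 (Set.Ioi 0)) (nhds 0) := by
      have : Continuous fun ρ : ℝ => C₀ * ρ * |θ - 0| := by fun_prop
      simpa using (this.tendsto 0).mono_left nhdsWithin_le_nhds
    have hdiff : Filter.Tendsto (fun ρ => u ρ θ - u ρ 0)
        (nhdsWithin 0 (Set.Ioi 0)) (nhds 0) := by
      refine squeeze_zero_norm' ?_ hid
      filter_upwards [hnear] with ρ hρ
      exact convex_univ.norm_image_sub_le_of_norm_hasDerivWithin_le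
        (fun x _ => (hs.hasDerivAt_pd_theta hρ.1 hρ.2 x).hasDerivWithinAt)
        (fun x _ => htheta ρ x hρ.1 hρ.2) (mem_univ _) (mem_univ _)
    simpa using hdiff.add hc
  have hdecay : WeightedBound (1 + α) (fun ρ θ => u ρ θ - c) := by
    refine ⟨C₀, fun ρ θ h0 h1 => ?_⟩
    refine le_of_tendsto ((htend θ).const_sub (u ρ θ)).abs ?_
    filter_upwards [Ioo_mem_nhdsGT h0] with s hs
    refine (hmv θ ρ s hs.1 hs.2.le h1).trans ?_
    rw [rpow_add h0, rpow_one, mul_comm ρ, ← mul_assoc]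
    exact mul_le_mul_of_nonneg_left (by linarith [hs.1]) (by positivity)
  have hmain (q : ℝ) (hq : q < 1 + α) : OTilde q (fun ρ θ => u ρ θ - c) :=
    (hu.sub_const c).of_weightedBound hdecay hq
  exact ⟨c, htend, fun q _ hq => hmain q hq, 1 + α / 2, by linarith, hmain _ (by linarith)⟩
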